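/- arXiv:2404.01245 — 2 statements merged into one kernel-verified Lean document; each statement's English description precedes it below -/
import Mathlib

section
/- Let W be a finite vocabulary with |W| ≥ 2 and fix Δ ∈ (0, 1 − 1/|W|]. For every nondecreasing function h : [0,1] → ℝ, sup_{P ∈ 𝒫_Δ} ∫_{[0,1]} e^{−h(r)} μ_{1,P}(dr) = ∫_{[0,1]} e^{−h(r)} μ_{1,P*_Δ}(dr), where both sides take values in (0, ∞]. Consequently, the class-dependent efficiency rate satisfies R_{𝒫_Δ}(h) = − inf_{θ≥0} ( θ·∫_0^1 h(r) dr + log ∫_{[0,1]} e^{−θ h(r)} μ_{1,P*_Δ}(dr) ). -/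
open MeasureTheory
open scoped ENNReal

/-- The simplex of probability vectors on `Fin m`. -/
def probSimplex (m : ℕ) : Set (Fin m → ℝ) :=
  {P | (∀ w, 0 ≤ P w) ∧ ∑ w, P w = 1}

/-- The `Δ`-regular class `𝒫_Δ = {P ∈ Simp : max_w P_w ≤ 1-Δ}`. -/
def regularClass (m : ℕ) (Δ : ℝ) : Set (Fin m → ℝ) :=
  {P | P ∈ probSimplex m ∧ ∀ w, P w ≤ 1 - Δ}

/-- The least-favorable distribution `P*_Δ`. -/
noncomputable def leastFavorable (m : ℕ) (Δ : ℝ) : Fin m → ℝ := fun i =>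
  if (i : ℕ) < ⌊1 / (1 - Δ)⌋₊ then 1 - Δ
  else if (i : ℕ) = ⌊1 / (1 - Δ)⌋₊ then 1 - (1 - Δ) * ⌊1 / (1 - Δ)⌋₊
  else 0

/-- For `r ∈ [0, 1]`, the perspective function `p ↦ p * r ^ (1 / p)` is convex on `[0, ∞)`. -/
lemma convexOn_mul_rpow_one_div {r : ℝ} (hr0 : 0 ≤ r) (hr1 : r ≤ 1) :
    ConvexOn ℝ (Set.Ici 0) fun p : ℝ => p * r ^ (1 / p) := by
  refine ⟨convex_Ici 0, ?_⟩
  intro x hx y hy a b ha hb hab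
  simp only [Set.mem_Ici, smul_eq_mul] at *
  rcases hr0.eq_or_lt with rfl | hr
  · have h0 : ∀ p : ℝ, p * (0 : ℝ) ^ (1 / p) = 0 := by
      intro p
      rcases eq_or_ne p 0 with rfl | hp
      · simp
      · rw [Real.zero_rpow (one_div_ne_zero hp), mul_zero]
    simp only [h0, mul_zero, add_zero, le_refl]
  have scale : ∀ t z : ℝ, 0 ≤ t → t ≤ 1 → 0 ≤ z →
      t * z * r ^ (1 / (t * z)) ≤ t * (z * r ^ (1 / z)) := by
    intro t z ht ht1 hz
    rcases (mul_nonneg ht hz).eq_or_lt with h0 | h0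
    · rw [← h0, zero_mul]; positivity
    · rw [← mul_assoc]
      refine mul_le_mul_of_nonneg_left ?_ h0.le
      refine Real.rpow_le_rpow_of_exponent_ge hr hr1 ?_
      exact one_div_le_one_div_of_le h0 (mul_le_of_le_one_left hz ht1)
  rcases hx.eq_or_lt with rfl | hx
  · simpa using scale b y hb (by linarith) hy
  rcases hy.eq_or_lt with rfl | hy
  · simpa using scale a x ha (by linarith) hx.le
  have hz : 0 < a * x + b * y := by
    rcases ha.eq_or_lt with rfl | ha
    · obtain rfl : b = 1 := by linarith
      simpa using hy
    · positivity
  have key := Real.geom_mean_le_arith_mean2_weighted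
    (w₁ := a * x / (a * x + b * y)) (w₂ := b * y / (a * x + b * y))
    (p₁ := r ^ (1 / x)) (p₂ := r ^ (1 / y)) (by positivity) (by positivity)
    (by positivity) (by positivity) (by field_simp)
  rw [← Real.rpow_mul hr.le, ← Real.rpow_mul hr.le, ← Real.rpow_add hr] at key
  have hexp : 1 / x * (a * x / (a * x + b * y)) + 1 / y * (b * y / (a * x + b * y))
      = 1 / (a * x + b * y) := by
    field_simp
    rw [hab]
  rw [hexp] at key
  calc (a * x + b * y) * r ^ (1 / (a * x + b * y))
      ≤ (a * x + b * y) * (a * x / (a * x + b * y) * r ^ (1 / x)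
          + b * y / (a * x + b * y) * r ^ (1 / y)) :=
        mul_le_mul_of_nonneg_left key hz.le
    _ = a * (x * r ^ (1 / x)) + b * (y * r ^ (1 / y)) := by field_simp

/-- Spreading two points apart while keeping their sum increases the sum of a convex function. -/
lemma ConvexOn.add_le_add_of_spread {s : Set ℝ} {f : ℝ → ℝ} (hf : ConvexOn ℝ s f)
    {u v x y : ℝ} (hu : u ∈ s) (hv : v ∈ s) (hux : u ≤ x) (hxv : x ≤ v)
    (hsum : x + y = u + v) : f x + f y ≤ f u + f v := by
  rcases (hux.trans hxv).eq_or_lt with rfl | huv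
  · obtain rfl : x = u := le_antisymm hxv hux
    obtain rfl : y = x := by linarith
    exact le_rfl
  have hd : 0 < v - u := sub_pos.2 huv
  have ha : 0 ≤ (v - x) / (v - u) := div_nonneg (by linarith) hd.le
  have hb : 0 ≤ (x - u) / (v - u) := div_nonneg (by linarith) hd.le
  have hab : (v - x) / (v - u) + (x - u) / (v - u) = 1 := by field_simp; ring
  have h1 := hf.2 hu hv ha hb hab
  have h2 := hf.2 hu hv hb ha (by linarith)
  have e1 : (v - x) / (v - u) * u + (x - u) / (v - u) * v = x := by field_simp; ring
  have e2 : (x - u) / (v - u) * u + (v - x) / (v - u) * v = y := by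
    obtain rfl : y = u + v - x := by linarith
    field_simp; ring
  simp only [smul_eq_mul] at h1 h2
  rw [e1] at h1
  rw [e2] at h2
  linear_combination h1 + h2 + (f u + f v) * hab

/-- The value of a separable functional at the greedy allocation of total mass `s` into cells of
capacity `c`. -/
noncomputable def greedyValue (f : ℝ → ℝ) (c s : ℝ) : ℝ :=
  ⌊s / c⌋₊ * f c + f (s - c * ⌊s / c⌋₊)

lemma greedyValue_add_le {f : ℝ → ℝ} (hf : ConvexOn ℝ (Set.Ici 0) f) (hf0 : f 0 = 0)
    {c s p : ℝ} (hc : 0 < c) (hs : 0 ≤ s) (hp : 0 ≤ p) (hpc : p ≤ c) :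
    greedyValue f c s + f p ≤ greedyValue f c (s + p) := by
  unfold greedyValue
  set k := ⌊s / c⌋₊ with hk
  have hk1 : (k : ℝ) * c ≤ s := (le_div_iff₀ hc).1 (Nat.floor_le (by positivity))
  have hk2 : s < (k + 1) * c := (div_lt_iff₀ hc).1 (Nat.lt_floor_add_one _)
  rcases lt_or_ge (s + p) ((k + 1) * c) with hlt | hge
  · have hfl : ⌊(s + p) / c⌋₊ = k := by
      rw [Nat.floor_eq_iff (by positivity), le_div_iff₀ hc, div_lt_iff₀ hc]
      exact ⟨by linarith, hlt⟩
    rw [hfl]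
    have := hf.add_le_add_of_spread (u := 0) (v := s + p - c * k) (x := s - c * k) (y := p)
      (by simp) (by simp only [Set.mem_Ici]; linarith) (by linarith) (by linarith) (by ring)
    linarith
  · have hfl : ⌊(s + p) / c⌋₊ = k + 1 := by
      rw [Nat.floor_eq_iff (by positivity), le_div_iff₀ hc, div_lt_iff₀ hc]
      push_cast
      exact ⟨hge, by linarith⟩
    rw [hfl]
    push_cast
    have := hf.add_le_add_of_spread (u := s + p - c * (k + 1)) (v := c) (x := s - c * k) (y := p)
      (by simp only [Set.mem_Ici]; linarith) hc.le (by linarith) (by linarith) (by ring)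
    linarith

/-- Greedy allocation maximizes a convex separable functional under a capacity constraint. -/
lemma sum_le_greedyValue {ι : Type*} {f : ℝ → ℝ} (hf : ConvexOn ℝ (Set.Ici 0) f) (hf0 : f 0 = 0)
    {c : ℝ} (hc : 0 < c) (t : Finset ι) (p : ι → ℝ) (hp : ∀ i, 0 ≤ p i) (hpc : ∀ i, p i ≤ c) :
    ∑ i ∈ t, f (p i) ≤ greedyValue f c (∑ i ∈ t, p i) := by
  classical
  induction t using Finset.induction_on with
  | empty => simp [greedyValue, hf0]
  | insert a t ha ih =>
    rw [Finset.sum_insert ha, Finset.sum_insert ha, add_comm, add_comm (p a)]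
    have := greedyValue_add_le hf hf0 hc (Finset.sum_nonneg fun i (_ : i ∈ t) => hp i)
      (hp a) (hpc a)
    linarith

lemma sum_range_ite_lt_eq (k n : ℕ) (A B : ℝ) :
    ∑ i ∈ Finset.range n, (if i < k then A else if i = k then B else 0)
      = (min n k : ℕ) * A + if k < n then B else 0 := by
  induction n with
  | zero => simp
  | succ n ih =>
    rw [Finset.sum_range_succ, ih]
    rcases lt_trichotomy n k with h | rfl | h
    · rw [min_eq_left h.le, min_eq_left (Nat.succ_le_of_lt h), if_pos h, if_neg (by omega),
        if_neg (by omega)]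
      push_cast
      ring
    · simp
    · rw [min_eq_right h.le, min_eq_right (by omega)]
      simp [h, h.le, h.ne']

lemma sum_leastFavorable {m : ℕ} {Δ : ℝ} (hc : 0 < 1 - Δ) (hm : 1 ≤ m * (1 - Δ))
    {f : ℝ → ℝ} (hf0 : f 0 = 0) :
    ∑ i, f (leastFavorable m Δ i) = greedyValue f (1 - Δ) 1 := by
  unfold greedyValue leastFavorable
  set c := 1 - Δ
  set k := ⌊1 / c⌋₊
  have hk1 : (k : ℝ) * c ≤ 1 := (le_div_iff₀ hc).1 (Nat.floor_le (by positivity))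
  have hkm : k ≤ m := Nat.floor_le_of_le ((div_le_iff₀ hc).2 hm)
  simp only [apply_ite f, hf0]
  rw [Fin.sum_univ_eq_sum_range (fun i => if i < k then f c else if i = k then f (1 - c * k) else 0),
    sum_range_ite_lt_eq, min_eq_right hkm]
  rcases hkm.eq_or_lt with hkm | hkm
  · rw [if_neg (by omega)]
    have : 1 - c * k = 0 := by
      rw [hkm] at hk1 ⊢
      linarith
    rw [this, hf0]
  · rw [if_pos hkm]

lemma leastFavorable_mem_regularClass {m : ℕ} {Δ : ℝ} (hc : 0 < 1 - Δ) (hm : 1 ≤ m * (1 - Δ)) :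
    leastFavorable m Δ ∈ regularClass m Δ := by
  have hk1 : (⌊1 / (1 - Δ)⌋₊ : ℝ) * (1 - Δ) ≤ 1 :=
    (le_div_iff₀ hc).1 (Nat.floor_le (by positivity))
  have hk2 : 1 < ((⌊1 / (1 - Δ)⌋₊ : ℝ) + 1) * (1 - Δ) :=
    (div_lt_iff₀ hc).1 (Nat.lt_floor_add_one _)
  refine ⟨⟨fun i => ?_, ?_⟩, fun i => ?_⟩
  · unfold leastFavorable
    split_ifs <;> linarith
  · have := sum_leastFavorable hc hm (f := id) rfl
    simp only [greedyValue, id] at this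
    rw [this]
    ring
  · unfold leastFavorable
    split_ifs <;> linarith

/-- If `μ` is below `ν` on left half-lines, it is below `ν` on all lower sets. -/
lemma measure_le_of_isLowerSet {μ ν : Measure ℝ} (hle : ∀ a, μ (Set.Iic a) ≤ ν (Set.Iic a))
    {S : Set ℝ} (hS : IsLowerSet S) : μ S ≤ ν S := by
  obtain ⟨t, htc, hcof, hT⟩ : ∃ t : Set ℝ, t.Countable ∧ t ⊆ S ∧ S = ⋃ x ∈ t, Set.Iic x := by
    by_cases hmax : ∃ a ∈ S, ∀ x ∈ S, x ≤ a
    · obtain ⟨a, haS, ha⟩ := hmax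
      refine ⟨{a}, Set.countable_singleton a, by simpa using haS, ?_⟩
      ext x
      simpa using ⟨ha x, fun hx => hS hx haS⟩
    · push Not at hmax
      refine ⟨S ∩ Set.range ((↑) : ℚ → ℝ), (Set.countable_range _).mono Set.inter_subset_right,
        Set.inter_subset_left, ?_⟩
      ext x
      simp only [Set.mem_iUnion, Set.mem_Iic, exists_prop]
      refine ⟨fun hx => ?_, fun ⟨y, hy, hxy⟩ => hS hxy hy.1⟩
      obtain ⟨y, hyS, hxy⟩ := hmax x hx
      obtain ⟨q, hxq, hqy⟩ := exists_rat_btwn hxy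
      exact ⟨q, ⟨hS hqy.le hyS, q, rfl⟩, hxq.le⟩
  have hdir : DirectedOn (fun x y : ℝ => Set.Iic x ⊆ Set.Iic y) t :=
    (Std.Total.directedOn (r := (· ≤ ·)) t).mono fun _ _ => Set.Iic_subset_Iic.2
  rw [hT, measure_biUnion_eq_iSup htc hdir, measure_biUnion_eq_iSup htc hdir]
  exact iSup₂_mono fun x _ => hle x

/-- First-order stochastic dominance: antitone functions have larger integral under the measure
with larger distribution function. -/
lemma lintegral_le_of_antitone {μ ν : Measure ℝ} (hle : ∀ a, μ (Set.Iic a) ≤ ν (Set.Iic a))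
    {g : ℝ → ℝ} (hg : Antitone g) (hg0 : ∀ x, 0 ≤ g x) :
    ∫⁻ x, ENNReal.ofReal (g x) ∂μ ≤ ∫⁻ x, ENNReal.ofReal (g x) ∂ν := by
  rw [lintegral_eq_lintegral_meas_lt _ (ae_of_all _ hg0) hg.measurable.aemeasurable,
    lintegral_eq_lintegral_meas_lt _ (ae_of_all _ hg0) hg.measurable.aemeasurable]
  refine lintegral_mono fun t => measure_le_of_isLowerSet hle ?_
  intro x y hyx hx
  exact lt_of_lt_of_le hx (hg hyx)

lemma measure_Iic_zero_eq_zero {m : ℕ} {P : Fin m → ℝ} {μ : Measure ℝ}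
    (hμ : ∀ r ∈ Set.Icc (0 : ℝ) 1,
      μ (Set.Iic r) = ENNReal.ofReal (∑ w, P w * r ^ (1 / P w))) :
    μ (Set.Iic 0) = 0 := by
  rw [hμ 0 ⟨le_rfl, zero_le_one⟩, Finset.sum_eq_zero, ENNReal.ofReal_zero]
  intro w _
  rcases eq_or_ne (P w) 0 with h | h
  · rw [h, zero_mul]
  · rw [Real.zero_rpow (one_div_ne_zero h), mul_zero]

lemma measure_Iic_one_eq_one {m : ℕ} {P : Fin m → ℝ} {μ : Measure ℝ} (hP : ∑ w, P w = 1)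
    (hμ : ∀ r ∈ Set.Icc (0 : ℝ) 1,
      μ (Set.Iic r) = ENNReal.ofReal (∑ w, P w * r ^ (1 / P w))) :
    μ (Set.Iic 1) = 1 := by
  simp [hμ 1 ⟨zero_le_one, le_rfl⟩, hP]

/-- Stochastic dominance between probability measures carried by `(0, 1]`, tested on `exp (-u)`
for `u` nondecreasing on `[0, 1]`. -/
lemma lintegral_exp_neg_le_of_monotoneOn {μ ν : Measure ℝ} [IsProbabilityMeasure μ]
    [IsProbabilityMeasure ν] (hμ0 : μ (Set.Iic 0) = 0) (hν0 : ν (Set.Iic 0) = 0)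
    (hμ1 : μ (Set.Iic 1) = 1) (hν1 : ν (Set.Iic 1) = 1)
    (hle : ∀ a ∈ Set.Icc (0 : ℝ) 1, μ (Set.Iic a) ≤ ν (Set.Iic a))
    {u : ℝ → ℝ} (hu : MonotoneOn u (Set.Icc 0 1)) :
    ∫⁻ r, ENNReal.ofReal (Real.exp (-u r)) ∂μ ≤ ∫⁻ r, ENNReal.ofReal (Real.exp (-u r)) ∂ν := by
  let π : ℝ → ℝ := fun r => Set.projIcc (0 : ℝ) 1 zero_le_one r
  have hext : ∀ ρ : Measure ℝ, IsProbabilityMeasure ρ → ρ (Set.Iic 0) = 0 → ρ (Set.Iic 1) = 1 →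
      ∫⁻ r, ENNReal.ofReal (Real.exp (-u r)) ∂ρ
        = ∫⁻ r, ENNReal.ofReal (Real.exp (-u (π r))) ∂ρ := by
    intro ρ _ h0 h1
    refine lintegral_congr_ae ?_
    have h0' : ∀ᵐ r ∂ρ, r ∉ Set.Iic (0 : ℝ) := measure_eq_zero_iff_ae_notMem.1 h0
    have h1' : ∀ᵐ r ∂ρ, r ∈ Set.Iic (1 : ℝ) := (prob_compl_eq_zero_iff measurableSet_Iic).2 h1
    filter_upwards [h0', h1'] with r hr0 hr1
    have hr : r ∈ Set.Icc (0 : ℝ) 1 := ⟨(not_le.1 hr0).le, hr1⟩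
    simp only [π, Set.projIcc_of_mem zero_le_one hr]
  rw [hext μ inferInstance hμ0 hμ1, hext ν inferInstance hν0 hν1]
  refine lintegral_le_of_antitone (fun a => ?_) (g := fun r => Real.exp (-u (π r))) ?_
    fun _ => (Real.exp_pos _).le
  · rcases lt_or_ge a 0 with ha | ha
    · exact (measure_mono_null (Set.Iic_subset_Iic.2 ha.le) hμ0).trans_le zero_le
    rcases le_or_gt a 1 with ha1 | ha1
    · exact hle a ⟨ha, ha1⟩
    · exact prob_le_one.trans (hν1.symm.trans_le (measure_mono (Set.Iic_subset_Iic.2 ha1.le)))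
  · intro x y hxy
    exact Real.exp_le_exp.2 (neg_le_neg (hu (Subtype.prop _) (Subtype.prop _)
      (Set.monotone_projIcc zero_le_one hxy)))

/-- For any nondecreasing score function `h`, the worst-case moment generating
functional over the `Δ`-regular class is attained at the least-favorable
distribution `P*_Δ`; consequently the `𝒫_Δ`-efficiency rate is computed at `P*_Δ`.
Here `μ1 P` is the probability measure on `[0,1]` with CDF `r ↦ Σ_w P_w r^{1/P_w}`
and `μ0` is the uniform distribution on `[0,1]`. -/
theorem gumbel_worst_case_mgf
    (m : ℕ) (hm : 2 ≤ m) (Δ : ℝ) (hΔ : 0 < Δ) (hΔ' : Δ ≤ 1 - 1 / m)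
    (μ1 : (Fin m → ℝ) → Measure ℝ)
    (hμprob : ∀ P ∈ probSimplex m, IsProbabilityMeasure (μ1 P))
    (hμcdf : ∀ P ∈ probSimplex m, ∀ r ∈ Set.Icc (0:ℝ) 1,
      μ1 P (Set.Iic r) = ENNReal.ofReal (∑ w, P w * r ^ (1 / P w)))
    (μ0 : Measure ℝ) (hμ0 : μ0 = volume.restrict (Set.Icc (0:ℝ) 1))
    (h : ℝ → ℝ) (hmono : MonotoneOn h (Set.Icc 0 1)) :
    (⨆ P ∈ regularClass m Δ, ∫⁻ r, ENNReal.ofReal (Real.exp (-h r)) ∂(μ1 P))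
      = ∫⁻ r, ENNReal.ofReal (Real.exp (-h r)) ∂(μ1 (leastFavorable m Δ))
    ∧ -(⨅ θ ∈ Set.Ici (0:ℝ), ⨆ P ∈ regularClass m Δ,
          (((θ * ∫ r, h r ∂μ0 : ℝ) : EReal)
            + ENNReal.log (∫⁻ r, ENNReal.ofReal (Real.exp (-θ * h r)) ∂(μ1 P))))
      = -(⨅ θ ∈ Set.Ici (0:ℝ),
          (((θ * ∫ r, h r ∂μ0 : ℝ) : EReal)
            + ENNReal.log (∫⁻ r, ENNReal.ofReal (Real.exp (-θ * h r))
                ∂(μ1 (leastFavorable m Δ))))) := by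
  have hm0 : (0 : ℝ) < m := by exact_mod_cast (by omega : 0 < m)
  have hc : 0 < 1 - Δ := by
    have : (0 : ℝ) < 1 / m := by positivity
    linarith
  have hmc : 1 ≤ m * (1 - Δ) := by
    have : m * (1 / (m : ℝ)) ≤ m * (1 - Δ) := mul_le_mul_of_nonneg_left (by linarith) hm0.le
    rwa [mul_one_div_cancel hm0.ne'] at this
  have hstar := leastFavorable_mem_regularClass hc hmc
  have key : ∀ u : ℝ → ℝ, MonotoneOn u (Set.Icc 0 1) → ∀ P ∈ regularClass m Δ,
      ∫⁻ r, ENNReal.ofReal (Real.exp (-u r)) ∂(μ1 P)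
        ≤ ∫⁻ r, ENNReal.ofReal (Real.exp (-u r)) ∂(μ1 (leastFavorable m Δ)) := by
    intro u hu P hP
    have := hμprob P hP.1
    have := hμprob _ hstar.1
    refine lintegral_exp_neg_le_of_monotoneOn (measure_Iic_zero_eq_zero (hμcdf P hP.1))
      (measure_Iic_zero_eq_zero (hμcdf _ hstar.1))
      (measure_Iic_one_eq_one hP.1.2 (hμcdf P hP.1))
      (measure_Iic_one_eq_one hstar.1.2 (hμcdf _ hstar.1)) (fun a ha => ?_) hu
    rw [hμcdf P hP.1 a ha, hμcdf _ hstar.1 a ha]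
    refine ENNReal.ofReal_le_ofReal ?_
    have hf0 : (0 : ℝ) * a ^ (1 / (0 : ℝ)) = 0 := zero_mul _
    have hle := sum_le_greedyValue (convexOn_mul_rpow_one_div ha.1 ha.2) hf0 hc Finset.univ P
      hP.1.1 hP.2
    rw [hP.1.2] at hle
    exact hle.trans_eq (sum_leastFavorable hc hmc (f := fun p => p * a ^ (1 / p)) hf0).symm
  refine ⟨le_antisymm (iSup₂_le (key h hmono)) (le_iSup₂_of_le _ hstar le_rfl), ?_⟩
  congr 1
  refine iInf_congr fun θ => iInf_congr fun hθ => le_antisymm (iSup₂_le fun P hP => ?_)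
    (le_iSup₂_of_le _ hstar le_rfl)
  refine add_le_add le_rfl (ENNReal.log_monotone ?_)
  simpa only [neg_mul] using key (fun r => θ * h r)
    (fun x hx y hy hxy => mul_le_mul_of_nonneg_left (hmono hx hy hxy) hθ) P hP
end

section
/- Adopt the inverse-transform setup and let r ∈ [0,1]. (i) (Null hypothesis) If w is any W-valued random variable independent of the pair (π, U), then the statistic Y = |U − η(π(w))| satisfies P( Y ≤ r ) = (1/M) · Σ_{i=1}^{M} [ min{η(i)+r, 1} − max{η(i)−r, 0} ]. (ii) (Alternative hypothesis) If w = π^{-1}(k(π,U)) is the token produced by the inverse-transform decoder with probability vector P, then Y^dif = |U − η(π(w))| satisfies P( Y^dif ≤ r ) = (1/M!) · Σ_{π'∈S_M} Σ_{i=1}^{M} λ( (a_{π',i−1}, a_{π',i}] ∩ B(η(i), r) ), where B(v,r) = { x ∈ [0,1] : |x − v| ≤ r }. -/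
open MeasureTheory
open scoped ENNReal

/-- The uniform distribution on `(0,1)`. -/
noncomputable def unifMeasure : Measure ℝ := volume.restrict (Set.Ioo 0 1)

instance permMeasurableSpace (M : ℕ) : MeasurableSpace (Equiv.Perm (Fin M)) := ⊤

/-- The uniform distribution on permutations of `Fin M`. -/
noncomputable def permUnif (M : ℕ) : Measure (Equiv.Perm (Fin M)) :=
  (PMF.uniformOfFintype (Equiv.Perm (Fin M))).toMeasure

/-- Partial sums `a_{σ,i} = Σ_{j<i} P_{σ(j)}` (0-based indexing). -/
def cumsum {M : ℕ} (P : Fin M → ℝ) (σ : Equiv.Perm (Fin M)) (i : ℕ) : ℝ :=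
  ∑ j : Fin M, if (j : ℕ) < i then P (σ j) else 0

/-- The normalization `η(i) = (i-1)/(M-1)` (with 0-based indexing, `i/(M-1)`). -/
noncomputable def eta (M : ℕ) (i : Fin M) : ℝ := (i : ℕ) / ((M : ℝ) - 1)

/-- The ball `B(v,r) = {x ∈ [0,1] : |x - v| ≤ r}`. -/
def ballB (v r : ℝ) : Set ℝ := {x : ℝ | x ∈ Set.Icc (0:ℝ) 1 ∧ |x - v| ≤ r}

instance permDiscreteMeasurableSpace (M : ℕ) : DiscreteMeasurableSpace (Equiv.Perm (Fin M)) :=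
  ⟨fun _ => trivial⟩

instance isProbabilityMeasure_permUnif (M : ℕ) : IsProbabilityMeasure (permUnif M) := by
  unfold permUnif; infer_instance

theorem unifMeasure_eq_restrict_Ioc : unifMeasure = volume.restrict (Set.Ioc 0 1) :=
  Measure.restrict_congr_set Ioo_ae_eq_Ioc

theorem unifMeasure_eq_restrict_Icc : unifMeasure = volume.restrict (Set.Icc 0 1) :=
  Measure.restrict_congr_set Ioo_ae_eq_Icc

instance isFiniteMeasure_unifMeasure : IsFiniteMeasure unifMeasure := by
  rw [unifMeasure_eq_restrict_Icc]; infer_instance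

theorem permUnif_singleton (M : ℕ) (σ : Equiv.Perm (Fin M)) :
    permUnif M {σ} = (M.factorial : ℝ≥0∞)⁻¹ := by
  rw [permUnif, PMF.toMeasure_apply_singleton _ _ (measurableSet_singleton σ)]
  simp [Fintype.card_perm]

/-- A permutation-uniform product measure is an average of the measures of the sections. -/
theorem permUnif_prod_apply (M : ℕ) {S : Set (Equiv.Perm (Fin M) × ℝ)} (hS : MeasurableSet S) :
    ((permUnif M).prod unifMeasure) S
      = (M.factorial : ℝ≥0∞)⁻¹ * ∑ σ : Equiv.Perm (Fin M), unifMeasure (Prod.mk σ ⁻¹' S) := by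
  rw [Measure.prod_apply hS, lintegral_fintype, Finset.mul_sum]
  refine Finset.sum_congr rfl fun σ _ => ?_
  rw [permUnif_singleton, mul_comm]

theorem cumsum_mono {M : ℕ} {P : Fin M → ℝ} (hnn : ∀ w, 0 ≤ P w) (σ : Equiv.Perm (Fin M)) :
    Monotone (cumsum P σ) := by
  intro a b hab
  refine Finset.sum_le_sum fun j _ => ?_
  by_cases h : (j : ℕ) < a
  · simp [h, h.trans_le hab]
  · rw [if_neg h]
    split_ifs
    exacts [hnn _, le_rfl]

theorem cumsum_zero {M : ℕ} (P : Fin M → ℝ) (σ : Equiv.Perm (Fin M)) : cumsum P σ 0 = 0 := by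
  simp [cumsum]

theorem cumsum_card {M : ℕ} (P : Fin M → ℝ) (σ : Equiv.Perm (Fin M)) :
    cumsum P σ M = ∑ w, P w := by
  simp [cumsum, Equiv.sum_comp σ P]

/-- The index selected by the decoder is characterised by the half-open cumulative cell. -/
theorem eq_iff_mem_Ioc_cumsum {M : ℕ} {P : Fin M → ℝ} (hnn : ∀ w, 0 ≤ P w)
    (σ : Equiv.Perm (Fin M)) {u : ℝ} (hu : 0 < u) {k : Fin M}
    (hk : IsLeast {i : Fin M | u ≤ cumsum P σ ((i : ℕ) + 1)} k) (i : Fin M) :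
    i = k ↔ u ∈ Set.Ioc (cumsum P σ (i : ℕ)) (cumsum P σ ((i : ℕ) + 1)) := by
  constructor
  · rintro rfl
    refine ⟨?_, hk.1⟩
    by_contra! hle
    obtain ⟨n, hn⟩ := i
    cases n with
    | zero =>
      rw [cumsum_zero] at hle
      exact absurd hu hle.not_gt
    | succ n =>
      have h : (⟨n + 1, hn⟩ : Fin M) ≤ ⟨n, by omega⟩ := hk.2 hle
      rw [Fin.mk_le_mk] at h
      omega
  · rintro ⟨h1, h2⟩
    refine le_antisymm ?_ (hk.2 h2)
    by_contra! hlt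
    have h3 : u ≤ cumsum P σ ((k : ℕ) + 1) := hk.1
    have hlt' : (k : ℕ) + 1 ≤ (i : ℕ) := hlt
    exact absurd (h3.trans (cumsum_mono hnn σ hlt')) h1.not_ge

theorem measurableSet_ballB (v r : ℝ) : MeasurableSet (ballB v r) :=
  measurableSet_Icc.inter
    (measurableSet_le (f := fun x : ℝ => |x - v|) (by fun_prop) measurable_const)

theorem eta_mem_Icc {M : ℕ} (hM : 2 ≤ M) (i : Fin M) : eta M i ∈ Set.Icc (0 : ℝ) 1 := by
  have hM' : (2 : ℝ) ≤ M := by exact_mod_cast hM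
  have hi : ((i : ℕ) : ℝ) + 1 ≤ M := by exact_mod_cast i.isLt
  unfold eta
  constructor
  · exact div_nonneg (Nat.cast_nonneg _) (by linarith)
  · rw [div_le_one (by linarith)]
    linarith

theorem unifMeasure_abs_sub_le (v r : ℝ) :
    unifMeasure {u | |u - v| ≤ r} = ENNReal.ofReal (min (v + r) 1 - max (v - r) 0) := by
  have h : {u : ℝ | |u - v| ≤ r} = Set.Icc (v - r) (v + r) := by
    ext u
    simp only [Set.mem_ofPred_eq, Set.mem_Icc, abs_le]
    constructor <;> rintro ⟨h1, h2⟩ <;> constructor <;> linarith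
  rw [h, unifMeasure_eq_restrict_Icc, Measure.restrict_apply measurableSet_Icc,
    Set.Icc_inter_Icc, Real.volume_Icc]

/-- The image of a fixed point under a uniform permutation is uniform. -/
theorem inv_factorial_mul_sum_perm_apply {M : ℕ} (f : Fin M → ℝ≥0∞) (w : Fin M) :
    (M.factorial : ℝ≥0∞)⁻¹ * ∑ σ : Equiv.Perm (Fin M), f (σ w)
      = (M : ℝ≥0∞)⁻¹ * ∑ i, f i := by
  have hconst (v : Fin M) :
      ∑ σ : Equiv.Perm (Fin M), f (σ v) = ∑ σ : Equiv.Perm (Fin M), f (σ w) := by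
    rw [← Equiv.sum_comp (Equiv.mulRight (Equiv.swap v w))]
    simp
  have htotal : (M : ℝ≥0∞) * ∑ σ : Equiv.Perm (Fin M), f (σ w)
      = (M.factorial : ℝ≥0∞) * ∑ i, f i := by
    calc (M : ℝ≥0∞) * ∑ σ : Equiv.Perm (Fin M), f (σ w)
        = ∑ v : Fin M, ∑ σ : Equiv.Perm (Fin M), f (σ v) := by simp [hconst]
      _ = ∑ σ : Equiv.Perm (Fin M), ∑ v : Fin M, f (σ v) := Finset.sum_comm
      _ = (M.factorial : ℝ≥0∞) * ∑ i, f i := by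
        simp [fun σ : Equiv.Perm (Fin M) => Equiv.sum_comp σ f, Fintype.card_perm]
  have hM0 : (M : ℝ≥0∞) ≠ 0 := by exact_mod_cast w.pos.ne'
  have hF0 : (M.factorial : ℝ≥0∞) ≠ 0 := by exact_mod_cast M.factorial_ne_zero
  calc (M.factorial : ℝ≥0∞)⁻¹ * ∑ σ : Equiv.Perm (Fin M), f (σ w)
      = (M.factorial : ℝ≥0∞)⁻¹ *
          ((M : ℝ≥0∞)⁻¹ * ((M : ℝ≥0∞) * ∑ σ : Equiv.Perm (Fin M), f (σ w))) := by
        rw [ENNReal.inv_mul_cancel_left hM0 (ENNReal.natCast_ne_top _)]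
    _ = (M : ℝ≥0∞)⁻¹ * ∑ i, f i := by
        rw [htotal, mul_left_comm, ENNReal.inv_mul_cancel_left hF0 (ENNReal.natCast_ne_top _)]

theorem measurableSet_null_statistic_le (M : ℕ) (r : ℝ) :
    MeasurableSet
      {p : Fin M × (Equiv.Perm (Fin M) × ℝ) | |p.2.2 - eta M (p.2.1 p.1)| ≤ r} := by
  have h : Measurable fun p : Fin M × (Equiv.Perm (Fin M) × ℝ) => eta M (p.2.1 p.1) :=
    (Measurable.of_discrete (f := fun q : Fin M × Equiv.Perm (Fin M) => eta M (q.2 q.1))).comp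
      (measurable_fst.prodMk (measurable_fst.comp measurable_snd))
  exact measurableSet_le
    ((measurable_snd.comp measurable_snd).sub h).abs measurable_const

theorem permUnif_prod_null_statistic_le {M : ℕ} (hM : 2 ≤ M) {r : ℝ} (hr : 0 ≤ r) (w : Fin M) :
    ((permUnif M).prod unifMeasure) {q | |q.2 - eta M (q.1 w)| ≤ r}
      = ENNReal.ofReal ((1 / (M : ℝ)) *
          ∑ i : Fin M, (min (eta M i + r) 1 - max (eta M i - r) 0)) := by
  have hmeas : MeasurableSet {q : Equiv.Perm (Fin M) × ℝ | |q.2 - eta M (q.1 w)| ≤ r} :=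
    measurable_prodMk_left (x := w) (measurableSet_null_statistic_le M r)
  have hnonneg (i : Fin M) : 0 ≤ min (eta M i + r) 1 - max (eta M i - r) 0 := by
    obtain ⟨h0, h1⟩ := eta_mem_Icc hM i
    rw [sub_nonneg, le_min_iff, max_le_iff, max_le_iff]
    refine ⟨⟨?_, ?_⟩, ?_, ?_⟩ <;> linarith
  have hMpos : (0 : ℝ) < M := by exact_mod_cast w.pos
  rw [permUnif_prod_apply M hmeas]
  simp only [Set.preimage_ofPred_eq, unifMeasure_abs_sub_le]
  rw [inv_factorial_mul_sum_perm_apply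
      (fun i => ENNReal.ofReal (min (eta M i + r) 1 - max (eta M i - r) 0)) w,
    ENNReal.ofReal_mul (by positivity), ENNReal.ofReal_sum_of_nonneg fun i _ => hnonneg i,
    one_div, ENNReal.ofReal_inv_of_pos hMpos, ENNReal.ofReal_natCast]

/-- Uniform measure of the part of `(0,1]` where the decoder statistic is at most `r`. -/
theorem unifMeasure_iUnion_cells {M : ℕ} {P : Fin M → ℝ} (hnn : ∀ w, 0 ≤ P w)
    (hsum : ∑ w, P w = 1) (σ : Equiv.Perm (Fin M)) (r : ℝ) :
    unifMeasure (⋃ i : Fin M,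
        Set.Ioc (cumsum P σ (i : ℕ)) (cumsum P σ ((i : ℕ) + 1)) ∩ ballB (eta M i) r)
      = ∑ i : Fin M, volume
          (Set.Ioc (cumsum P σ (i : ℕ)) (cumsum P σ ((i : ℕ) + 1)) ∩ ballB (eta M i) r) := by
  have hm := cumsum_mono hnn σ
  have hdisj : Pairwise (Function.onFun Disjoint fun i : Fin M =>
      Set.Ioc (cumsum P σ (i : ℕ)) (cumsum P σ ((i : ℕ) + 1)) ∩ ballB (eta M i) r) :=
    fun i j hij => ((hm.pairwise_disjoint_on_Ioc_succ
      (Fin.val_injective.ne hij)).mono Set.inter_subset_left Set.inter_subset_left)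
  rw [measure_iUnion hdisj fun i => measurableSet_Ioc.inter (measurableSet_ballB _ _),
    tsum_fintype]
  refine Finset.sum_congr rfl fun i _ => ?_
  rw [unifMeasure_eq_restrict_Ioc, Measure.restrict_eq_self]
  refine Set.inter_subset_left.trans (Set.Ioc_subset_Ioc ?_ ?_)
  · exact (cumsum_zero P σ).symm.le.trans (hm (Nat.zero_le _))
  · exact (hm i.isLt).trans ((cumsum_card P σ).trans hsum).le

/-- Law of the inverse-transform detection statistic `Y = |U - η(π(w))|`:
(i) under the null hypothesis (token independent of `(π,U)`), and (ii) under the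
alternative (token produced by the inverse-transform decoder `w = π⁻¹(k(π,U))`). -/
theorem inverse_transform_statistic_law
    (M : ℕ) (hM : 2 ≤ M) (P : Fin M → ℝ)
    (hnn : ∀ w, 0 ≤ P w) (hsum : ∑ w, P w = 1)
    (kfun : Equiv.Perm (Fin M) → ℝ → Fin M)
    (hk : ∀ (σ : Equiv.Perm (Fin M)) (u : ℝ), 0 < u → u ≤ 1 →
      IsLeast {i : Fin M | u ≤ cumsum P σ⁻¹ ((i : ℕ) + 1)} (kfun σ u))
    (r : ℝ) (hr : r ∈ Set.Icc (0:ℝ) 1) :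
    (∀ (Ω : Type) [MeasurableSpace Ω] (μ : Measure Ω) [IsProbabilityMeasure μ]
        (wf : Ω → Fin M) (g : Ω → Equiv.Perm (Fin M) × ℝ),
      Measurable wf → Measurable g →
      μ.map g = (permUnif M).prod unifMeasure →
      ProbabilityTheory.IndepFun wf g μ →
        μ {ω | |(g ω).2 - eta M ((g ω).1 (wf ω))| ≤ r}
          = ENNReal.ofReal ((1 / (M : ℝ)) *
              ∑ i : Fin M, (min (eta M i + r) 1 - max (eta M i - r) 0)))
    ∧ ((permUnif M).prod unifMeasure)
          {q : Equiv.Perm (Fin M) × ℝ |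
            |q.2 - eta M (q.1 (q.1⁻¹ (kfun q.1 q.2)))| ≤ r}
        = ((M.factorial : ℝ≥0∞))⁻¹ *
            ∑ σ : Equiv.Perm (Fin M), ∑ i : Fin M,
              volume (Set.Ioc (cumsum P σ (i : ℕ)) (cumsum P σ ((i : ℕ) + 1))
                ∩ ballB (eta M i) r) := by
  refine ⟨fun Ω _ μ _ wf g hwf hg hmap hind => ?_, ?_⟩
  · have hT := measurableSet_null_statistic_le M r
    have hlaw := (ProbabilityTheory.indepFun_iff_map_prod_eq_prod_map_map
      hwf.aemeasurable hg.aemeasurable).1 hind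
    have : IsProbabilityMeasure (μ.map wf) := Measure.isProbabilityMeasure_map hwf.aemeasurable
    calc μ {ω | |(g ω).2 - eta M ((g ω).1 (wf ω))| ≤ r}
        = μ.map (fun ω => (wf ω, g ω))
            {p : Fin M × (Equiv.Perm (Fin M) × ℝ) | |p.2.2 - eta M (p.2.1 p.1)| ≤ r} :=
          (Measure.map_apply (hwf.prodMk hg) hT).symm
      _ = _ := by
        rw [hlaw, hmap, Measure.prod_apply hT]
        simp only [Set.preimage_ofPred_eq, permUnif_prod_null_statistic_le hM hr.1]
        simp
  · let cells (σ : Equiv.Perm (Fin M)) : Set ℝ := ⋃ i : Fin M,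
      Set.Ioc (cumsum P σ (i : ℕ)) (cumsum P σ ((i : ℕ) + 1)) ∩ ballB (eta M i) r
    have hcells (σ : Equiv.Perm (Fin M)) : MeasurableSet (cells σ) :=
      MeasurableSet.iUnion fun i => measurableSet_Ioc.inter (measurableSet_ballB _ _)
    have hS : MeasurableSet {q : Equiv.Perm (Fin M) × ℝ | q.2 ∈ cells q.1⁻¹} :=
      by
      have hU : {q : Equiv.Perm (Fin M) × ℝ | q.2 ∈ cells q.1⁻¹} =
          ⋃ σ : Equiv.Perm (Fin M), {σ} ×ˢ cells σ⁻¹ := by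
        ext ⟨σ, u⟩
        simp
      rw [hU]
      exact MeasurableSet.iUnion fun σ => (measurableSet_singleton σ).prod (hcells σ⁻¹)
    have hae : {q : Equiv.Perm (Fin M) × ℝ |
          |q.2 - eta M (q.1 (q.1⁻¹ (kfun q.1 q.2)))| ≤ r}
        =ᵐ[(permUnif M).prod unifMeasure] {q | q.2 ∈ cells q.1⁻¹} := by
      have hunif : ∀ᵐ u ∂unifMeasure, u ∈ Set.Ioo (0 : ℝ) 1 :=
        ae_restrict_mem measurableSet_Ioo
      filter_upwards [Measure.quasiMeasurePreserving_snd.ae hunif] with q hq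
      have hcell := eq_iff_mem_Ioc_cumsum hnn q.1⁻¹ hq.1 (hk q.1 q.2 hq.1 hq.2.le)
      have hinv : q.1 (q.1⁻¹ (kfun q.1 q.2)) = kfun q.1 q.2 := q.1.apply_symm_apply _
      refine propext ?_
      change |q.2 - eta M (q.1 (q.1⁻¹ (kfun q.1 q.2)))| ≤ r ↔ q.2 ∈ cells q.1⁻¹
      simp only [cells, Set.mem_iUnion, Set.mem_inter_iff, ← hcell, exists_eq_left,
        hinv, ballB, Set.mem_ofPred_eq, Set.Ioo_subset_Icc_self hq, true_and]
    rw [measure_congr hae, permUnif_prod_apply M hS]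
    simp only [Set.preimage_ofPred_eq, Set.ofPred_mem_eq]
    have hreindex : ∑ σ : Equiv.Perm (Fin M), unifMeasure (cells σ⁻¹)
        = ∑ σ, unifMeasure (cells σ) :=
      Equiv.sum_comp (Equiv.inv (Equiv.Perm (Fin M))) fun σ => unifMeasure (cells σ)
    rw [hreindex]
    simp only [cells, unifMeasure_iUnion_cells hnn hsum]
end
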